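/- arXiv:2503.02317 — 2 statements merged into one kernel-verified Lean document; each statement's English description precedes it below -/
import Mathlib

section
/- Let n be a positive integer and let a_1 ≤ a_2 ≤ ⋯ be a nondecreasing sequence of positive integers with ∑_{i=1}^{∞} 1/a_i = 1/n. If a_i ≠ s_i(n) for some i, then liminf_{i→∞} a_i^{2^{-i}} < c_n, where c_n = lim_{i→∞} s_i(n)^{2^{-i}}. -/
open Filter Topology Finset

/-- `sylv n i` is the generalized Sylvester sequence term `s_{i+1}(n)`:
`s_1(n) = n + 1` and `s_{i+1}(n) = s_i(n)^2 - s_i(n) + 1`. -/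
def sylv (n : ℕ) : ℕ → ℕ
  | 0 => n + 1
  | i + 1 => sylv n i ^ 2 - sylv n i + 1


lemma sylv_ge (n : ℕ) (hn : 0 < n) (i : ℕ) : i + 2 ≤ sylv n i := by
  induction i with
  | zero => simp only [sylv]; omega
  | succ k ih =>
    simp only [sylv]
    have : sylv n k + (k + 2) ≤ sylv n k ^ 2 := by nlinarith
    omega

lemma sylv_succ_real (n : ℕ) (i : ℕ) :
    (sylv n (i + 1) : ℝ) = (sylv n i : ℝ) ^ 2 - sylv n i + 1 := by
  simp only [sylv]
  rw [Nat.cast_add, Nat.cast_sub (Nat.le_self_pow (by norm_num) _)]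
  push_cast; ring

lemma sylv_prod (n : ℕ) (k : ℕ) :
    (n : ℝ) * ∏ i ∈ range k, (sylv n i : ℝ) = sylv n k - 1 := by
  induction k with
  | zero => simp [sylv]
  | succ k ih => rw [prod_range_succ, ← mul_assoc, ih, sylv_succ_real]; ring

lemma sylv_prod_nat (n : ℕ) (k : ℕ) :
    n * ∏ i ∈ range k, sylv n i + 1 = sylv n k := by
  have := sylv_prod n k
  have h : ((n * ∏ i ∈ range k, sylv n i + 1 : ℕ) : ℝ) = sylv n k := by
    push_cast; linarith
  exact_mod_cast h

lemma sylv_shift (n k Q : ℕ) (hQ : Q + 1 = sylv n k) (i : ℕ) : sylv Q i = sylv n (i + k) := by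
  induction i with
  | zero => simp [sylv, hQ]
  | succ i ih => rw [show i + 1 + k = (i + k) + 1 by ring]; simp only [sylv]; rw [ih]

lemma sylv_partial (n : ℕ) (hn : 0 < n) (k : ℕ) :
    ∑ i ∈ range k, (1 : ℝ) / (sylv n i : ℝ) = 1 / n - 1 / ((sylv n k : ℝ) - 1) := by
  induction k with
  | zero => simp [sylv]
  | succ k ih =>
    rw [sum_range_succ, ih, sylv_succ_real]
    have h : (2 : ℝ) ≤ sylv n k := by
      have := sylv_ge n hn k
      exact_mod_cast (by omega : 2 ≤ sylv n k)
    have h1 : (sylv n k : ℝ) - 1 ≠ 0 := by linarith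
    have h2 : (sylv n k : ℝ) ≠ 0 := by linarith
    have h3 : (sylv n k : ℝ) ^ 2 - sylv n k + 1 - 1 = sylv n k * (sylv n k - 1) := by ring
    rw [h3]
    field_simp
    ring

lemma sylv_hasSum (n : ℕ) (hn : 0 < n) :
    HasSum (fun i => (1 : ℝ) / (sylv n i : ℝ)) (1 / n) := by
  rw [hasSum_iff_tendsto_nat_of_nonneg (fun i => by positivity)]
  simp_rw [sylv_partial n hn]
  have h : Tendsto (fun k => (sylv n k : ℝ) - 1) atTop atTop := by
    refine tendsto_atTop_mono (fun k => ?_) tendsto_natCast_atTop_atTop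
    have : ((k + 2 : ℕ) : ℝ) ≤ sylv n k := by exact_mod_cast sylv_ge n hn k
    push_cast at this; linarith
  have h2 := (h.inv_tendsto_atTop).const_sub (1 / (n : ℝ))
  simpa [one_div] using h2

/-- Abel summation. -/
lemma abel_nonneg (x l : ℕ → ℝ) (hx : Antitone x) (hx0 : ∀ i, 0 ≤ x i)
    (hl : ∀ m, 0 ≤ ∑ i ∈ range m, l i) (m : ℕ) : 0 ≤ ∑ i ∈ range m, x i * l i := by
  have key : ∀ m, x m * ∑ i ∈ range (m + 1), l i ≤ ∑ i ∈ range (m + 1), x i * l i := by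
    intro m
    induction m with
    | zero => simp
    | succ m ih =>
      rw [sum_range_succ (fun i => x i * l i), sum_range_succ l, mul_add]
      have := mul_le_mul_of_nonneg_right (hx (Nat.le_succ m)) (hl (m + 1))
      have h2 : x (m + 1) * ∑ i ∈ range (m + 1), l i ≤ x m * ∑ i ∈ range (m + 1), l i := this
      linarith
  cases m with
  | zero => simp
  | succ m => exact le_trans (mul_nonneg (hx0 _) (hl _)) (key m)

lemma majorize (a s : ℕ → ℝ) (ha : ∀ i, 0 < a i) (hs : ∀ i, 0 < s i) (hm : Monotone a)
    (hp : ∀ m, ∏ i ∈ range m, s i ≤ ∏ i ∈ range m, a i) (A S : ℝ)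
    (hA : HasSum (fun i => 1 / a i) A) (hS : HasSum (fun i => 1 / s i) S) (hAS : S ≤ A)
    (j : ℕ) : a j = s j := by
  by_contra hne
  have hr : ∀ i, 0 < a i / s i := fun i => div_pos (ha i) (hs i)
  have hg : ∀ i, 0 ≤ (1 / a i) * (a i / s i - 1 - Real.log (a i / s i)) := fun i =>
    mul_nonneg (by have := ha i; positivity) (by linarith [Real.log_le_sub_one_of_pos (hr i)])
  have hδ : 0 < (1 / a j) * (a j / s j - 1 - Real.log (a j / s j)) := by
    refine mul_pos (by have := ha j; positivity) ?_
    have : a j / s j ≠ 1 := by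
      rw [Ne, div_eq_one_iff_eq (hs j).ne']; exact hne
    linarith [Real.log_lt_sub_one_of_pos (hr j) this]
  have habel := abel_nonneg (fun i => 1 / a i) (fun i => Real.log (a i / s i))
    (fun i k h => one_div_le_one_div_of_le (ha i) (hm h))
    (fun i => by have := ha i; positivity)
    (fun m => by
      rw [← Real.log_prod (fun i _ => (hr i).ne')]
      apply Real.log_nonneg
      rw [prod_div_distrib, le_div_iff₀ (prod_pos fun i _ => hs i), one_mul]
      exact hp m)
  have hdiff := (hS.sub hA).tendsto_sum_nat
  have hlow : (1 / a j) * (a j / s j - 1 - Real.log (a j / s j)) ≤ S - A := by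
    refine ge_of_tendsto hdiff ?_
    filter_upwards [eventually_gt_atTop j] with m hmj
    have h1 : ∑ i ∈ range m, (1 / s i - 1 / a i)
        = ∑ i ∈ range m, (1 / a i) * (a i / s i - 1 - Real.log (a i / s i))
          + ∑ i ∈ range m, (1 / a i) * Real.log (a i / s i) := by
      rw [← sum_add_distrib]
      refine sum_congr rfl fun i _ => ?_
      have := (ha i).ne'
      have := (hs i).ne'
      field_simp
      ring
    rw [h1]
    have h2 := single_le_sum (f := fun i => (1 / a i) * (a i / s i - 1 - Real.log (a i / s i)))
      (fun i _ => hg i) (mem_range.2 hmj)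
    have := habel m
    beta_reduce at h2 this
    linarith
  linarith

lemma tail_int (b : ℕ → ℕ) (hb : ∀ i, 0 < b i) (p : ℤ) (q : ℕ) (hq : 0 < q) (j : ℕ) :
    ∃ p' : ℤ, (p : ℝ) / q - ∑ i ∈ range j, (1 : ℝ) / b i
      = p' / ((q * ∏ i ∈ range j, b i : ℕ) : ℝ) := by
  induction j with
  | zero => exact ⟨p, by simp⟩
  | succ j ih =>
    obtain ⟨p', h⟩ := ih
    refine ⟨p' * b j - (q * ∏ i ∈ range j, b i : ℕ), ?_⟩
    rw [sum_range_succ, ← sub_sub, h, prod_range_succ, ← mul_assoc]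
    have h1 : 0 < q * ∏ i ∈ range j, b i := Nat.mul_pos hq (prod_pos fun i _ => hb i)
    generalize q * ∏ i ∈ range j, b i = P at *
    have h2 : (P : ℝ) ≠ 0 := by positivity
    have h3 : (b j : ℝ) ≠ 0 := by have := hb j; positivity
    push_cast
    field_simp

lemma tail_hasSum (f : ℕ → ℝ) (A : ℝ) (h : HasSum f A) (j : ℕ) :
    HasSum (fun i => f (i + j)) (A - ∑ i ∈ range j, f i) := by
  rw [hasSum_nat_add_iff]
  simpa using h

lemma no_big (q : ℕ) (hq : 0 < q) (b : ℕ → ℕ) (hb : ∀ i, 0 < b i) (hm : Monotone b) (p : ℤ)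
    (hsum : HasSum (fun i => (1 : ℝ) / b i) ((p : ℝ) / q))
    (hbig : ∀ᶠ i in atTop, 2 * sylv q i ≤ b i) : False := by
  have hspos : ∀ i, 0 < sylv q i := fun i => by have := sylv_ge q hq i; omega
  obtain ⟨N, hN⟩ := eventually_atTop.1 hbig
  -- eventually the products are larger
  have hgrow : ∀ t, 2 ^ t * ∏ i ∈ range (N + t), sylv q i
      ≤ (∏ i ∈ range N, sylv q i) * ∏ i ∈ range (N + t), b i := by
    intro t
    induction t with
    | zero =>
      have : 0 < ∏ i ∈ range N, b i := prod_pos fun i _ => hb i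
      simp only [pow_zero, one_mul, add_zero]
      exact Nat.le_mul_of_pos_right _ this
    | succ t ih =>
      rw [← add_assoc, prod_range_succ, prod_range_succ]
      have := Nat.mul_le_mul ih (hN (N + t) (by omega))
      calc _ = _ := by rw [pow_succ]; ring
        _ ≤ _ := this
        _ = _ := by ring
  obtain ⟨T, hT⟩ : ∃ T, ∀ j, T ≤ j → ∏ i ∈ range j, sylv q i < ∏ i ∈ range j, b i := by
    refine ⟨N + ∏ i ∈ range N, sylv q i, fun j hj => ?_⟩
    obtain ⟨t, rfl⟩ : ∃ t, j = N + t := ⟨j - N, by omega⟩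
    have h1 := hgrow t
    have h2 : ∏ i ∈ range N, sylv q i < 2 ^ t :=
      lt_of_lt_of_le Nat.lt_two_pow_self (Nat.pow_le_pow_right (by norm_num) (by omega))
    have h3 : 0 < ∏ i ∈ range (N + t), sylv q i := prod_pos fun i _ => hspos i
    by_contra hcon
    push Not at hcon
    have h4 := Nat.mul_le_mul_left (∏ i ∈ range N, sylv q i) hcon
    have h5 := Nat.mul_lt_mul_of_pos_right h2 h3
    omega
  -- largest index with product not larger
  obtain ⟨j, hj, hjmax⟩ : ∃ j, ∏ i ∈ range j, b i ≤ ∏ i ∈ range j, sylv q i ∧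
      ∀ m, j < m → ∏ i ∈ range m, sylv q i < ∏ i ∈ range m, b i := by
    have hex : ∃ T, ∀ j, T ≤ j → ∏ i ∈ range j, sylv q i < ∏ i ∈ range j, b i := ⟨T, hT⟩
    classical
    have hspec := Nat.find_spec hex
    have hpos : Nat.find hex ≠ 0 := by
      intro h0
      have := hspec 0 (by omega)
      simp at this
    refine ⟨Nat.find hex - 1, ?_, fun m hm => hspec m (by omega)⟩
    by_contra hcon
    push Not at hcon
    refine Nat.find_min hex (m := Nat.find hex - 1) (by omega) fun m hm => ?_
    rcases hm.eq_or_lt with rfl | h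
    · exact hcon
    · exact hspec m (by omega)
  obtain ⟨p', hp'⟩ := tail_int b hb p q hq j
  have hA := tail_hasSum _ _ hsum j
  have hS := tail_hasSum _ _ (sylv_hasSum q hq) j
  rw [hp'] at hA
  rw [sylv_partial q hq, ← sylv_prod, sub_sub_cancel] at hS
  have hPb : 0 < ∏ i ∈ range j, b i := prod_pos fun i _ => hb i
  have hPs : 0 < ∏ i ∈ range j, sylv q i := prod_pos fun i _ => hspos i
  have hp1 : 1 ≤ p' := by
    have h0 : (0 : ℝ) < p' / ((q * ∏ i ∈ range j, b i : ℕ) : ℝ) := by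
      have h1 := hA.summable.sum_le_tsum {0} (fun i _ => by positivity)
      rw [hA.tsum_eq] at h1
      refine lt_of_lt_of_le ?_ h1
      simp [hb]
    have h2 : (0 : ℝ) < ((q * ∏ i ∈ range j, b i : ℕ) : ℝ) := by positivity
    have h3 : (0 : ℝ) < p' := (div_pos_iff_of_pos_right h2).1 h0
    have : 0 < p' := by exact_mod_cast h3
    omega
  have hAS : 1 / ((q : ℝ) * ∏ i ∈ range j, (sylv q i : ℝ))
      ≤ p' / ((q * ∏ i ∈ range j, b i : ℕ) : ℝ) := by
    have h1 : ((q * ∏ i ∈ range j, b i : ℕ) : ℝ) ≤ ((q * ∏ i ∈ range j, sylv q i : ℕ) : ℝ) := by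
      exact_mod_cast Nat.mul_le_mul_left q hj
    have h2 : (0 : ℝ) < ((q * ∏ i ∈ range j, b i : ℕ) : ℝ) := by positivity
    have h3 : (1 : ℝ) ≤ p' := by exact_mod_cast hp1
    calc _ = 1 / ((q * ∏ i ∈ range j, sylv q i : ℕ) : ℝ) := by push_cast; rfl
      _ ≤ 1 / ((q * ∏ i ∈ range j, b i : ℕ) : ℝ) := one_div_le_one_div_of_le h2 h1
      _ ≤ _ := by gcongr
  have hlt : ∀ m, 0 < m → ∏ i ∈ range m, sylv q (i + j) < ∏ i ∈ range m, b (i + j) := by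
    intro m hm0
    have h := hjmax (j + m) (by omega)
    rw [prod_range_add, prod_range_add] at h
    simp_rw [add_comm _ j]
    by_contra hcon
    push Not at hcon
    have := Nat.mul_le_mul hj hcon
    omega
  have hmaj := majorize (fun i => (b (i + j) : ℝ)) (fun i => (sylv q (i + j) : ℝ))
    (fun i => by exact_mod_cast hb _) (fun i => by exact_mod_cast hspos _)
    (fun x y h => by simpa using hm (by omega : x + j ≤ y + j))
    (fun m => by
      rcases Nat.eq_zero_or_pos m with rfl | h
      · simp
      · exact_mod_cast (hlt m h).le)
    _ _ hA hS hAS 0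
  have h0 := hlt 1 one_pos
  simp only [prod_range_one] at h0
  have : b (0 + j) = sylv q (0 + j) := by exact_mod_cast hmaj
  omega

lemma sylv_ratio (q Q : ℕ) (hq : 0 < q) (l : ℝ) (hl : 1 ≤ l)
    (h : l * (q + 1) ≤ (Q : ℝ) + 1) (i : ℕ) :
    l ^ (2 ^ i) * (sylv q i : ℝ) ≤ sylv Q i := by
  induction i with
  | zero => simpa [sylv] using h
  | succ i ih =>
    rw [sylv_succ_real, sylv_succ_real, pow_succ, pow_mul]
    have hL : 1 ≤ l ^ (2 ^ i) := one_le_pow₀ hl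
    generalize l ^ (2 ^ i) = L at *
    have hs : (2 : ℝ) ≤ sylv q i := by
      have := sylv_ge q hq i
      exact_mod_cast (by omega : 2 ≤ sylv q i)
    generalize (sylv q i : ℝ) = s at *
    generalize (sylv Q i : ℝ) = t at *
    have h1 : 0 ≤ (t - L * s) * (t + L * s - 1) :=
      mul_nonneg (by linarith) (by nlinarith)
    have h2 : 0 ≤ (L - 1) * (L * s - (L + 1)) :=
      mul_nonneg (by linarith) (by nlinarith)
    nlinarith

/-- Main theorem: if `a₁ ≤ a₂ ≤ ⋯` are positive integers with `∑ 1 / aᵢ = 1 / n` and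
`aᵢ ≠ s_i(n)` for some `i`, then `liminf aᵢ ^ (2⁻¹ ^ i) < c_n`
(here `a i = a_{i+1}` and `sylv n i = s_{i+1}(n)`). -/
theorem main_theorem (n : ℕ) (hn : 0 < n) (a : ℕ → ℕ)
    (hapos : ∀ i, 0 < a i) (hamono : Monotone a)
    (hsum : HasSum (fun i : ℕ => (1 : ℝ) / (a i : ℝ)) (1 / (n : ℝ)))
    (hne : ∃ i, a i ≠ sylv n i)
    (c : ℝ)
    (hc : Tendsto (fun i : ℕ => (sylv n i : ℝ) ^ ((2⁻¹ : ℝ) ^ (i + 1))) atTop (𝓝 c)) :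
    Filter.liminf (fun i : ℕ => (a i : ℝ) ^ ((2⁻¹ : ℝ) ^ (i + 1))) atTop < c := by
  by_contra hcon
  push Not at hcon
  have hspos : ∀ i, 0 < sylv n i := fun i => by have := sylv_ge n hn i; omega
  have hc1 : 1 ≤ c := by
    refine ge_of_tendsto hc (Eventually.of_forall fun i => ?_)
    exact Real.one_le_rpow (by exact_mod_cast hspos i) (by positivity)
  obtain ⟨k, hk⟩ : ∃ k, ∏ i ∈ range k, a i < ∏ i ∈ range k, sylv n i := by
    by_contra hno
    push Not at hno
    obtain ⟨i, hi⟩ := hne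
    apply hi
    have := majorize (fun i => (a i : ℝ)) (fun i => (sylv n i : ℝ))
      (fun i => by exact_mod_cast hapos i) (fun i => by exact_mod_cast hspos i)
      (fun x y h => by simpa using hamono h)
      (fun m => by exact_mod_cast hno m) _ _ hsum (sylv_hasSum n hn) le_rfl i
    exact_mod_cast this
  have hPa : 0 < ∏ i ∈ range k, a i := prod_pos fun i _ => hapos i
  have hq : 0 < n * ∏ i ∈ range k, a i := Nat.mul_pos hn hPa
  obtain ⟨p, hp⟩ := tail_int a hapos 1 n hn k
  have hA := tail_hasSum _ _ hsum k
  have hp2 : (1 : ℝ) / n - ∑ i ∈ range k, (1 : ℝ) / a i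
      = p / ((n * ∏ i ∈ range k, a i : ℕ) : ℝ) := by simpa using hp
  rw [hp2] at hA
  have hqQ : n * ∏ i ∈ range k, a i < n * ∏ i ∈ range k, sylv n i :=
    Nat.mul_lt_mul_of_pos_left hk hn
  have hshift := sylv_shift n k _ (sylv_prod_nat n k)
  generalize n * ∏ i ∈ range k, a i = q at *
  generalize n * ∏ i ∈ range k, sylv n i = Q at *
  refine no_big q hq (fun i => a (i + k)) (fun i => hapos _)
    (fun x y h => hamono (by omega : x + k ≤ y + k)) p hA ?_
  -- growth
  obtain ⟨l, hl1, hl⟩ : ∃ l : ℝ, 1 < l ∧ l * (q + 1) ≤ (Q : ℝ) + 1 := by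
    have : (q : ℝ) < Q := by exact_mod_cast hqQ
    refine ⟨((Q : ℝ) + 1) / (q + 1), ?_, ?_⟩
    · rw [one_lt_div (by positivity)]; linarith
    · rw [div_mul_cancel₀ _ (by positivity)]
  have hratio := sylv_ratio q Q hq l hl1.le hl
  -- choose r slightly below one
  obtain ⟨r, hr0, hr1, hr⟩ : ∃ r : ℝ, 0 < r ∧ r < 1 ∧ 1 < l * r ^ (2 ^ (k + 1)) := by
    have hcont : Tendsto (fun r : ℝ => l * r ^ (2 ^ (k + 1))) (𝓝[<] 1) (𝓝 (l * 1 ^ (2 ^ (k + 1)))) :=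
      ((continuous_const.mul (continuous_pow _)).tendsto 1).mono_left nhdsWithin_le_nhds
    have h1 := hcont.eventually (lt_mem_nhds (by simpa using hl1 : 1 < l * 1 ^ (2 ^ (k + 1))))
    have h2 : ∀ᶠ r : ℝ in 𝓝[<] 1, r < 1 := eventually_mem_nhdsWithin
    have h3 : ∀ᶠ r : ℝ in 𝓝[<] 1, 0 < r :=
      nhdsWithin_le_nhds (lt_mem_nhds (by norm_num))
    obtain ⟨r, h⟩ := (h1.and (h2.and h3)).exists
    exact ⟨r, h.2.2, h.2.1, h.1⟩
  -- d below c, and r * (s-term) eventually below d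
  obtain ⟨d, hd1, hd2⟩ : ∃ d, r * c < d ∧ d < c := exists_between (by nlinarith)
  have hev1 : ∀ᶠ i : ℕ in atTop, d < (a i : ℝ) ^ ((2⁻¹ : ℝ) ^ (i + 1)) :=
    eventually_lt_of_lt_liminf (lt_of_lt_of_le hd2 hcon)
      (isBoundedUnder_of ⟨0, fun i => by positivity⟩)
  have hev2 : ∀ᶠ i : ℕ in atTop, r * (sylv n i : ℝ) ^ ((2⁻¹ : ℝ) ^ (i + 1)) < d :=
    (hc.const_mul r).eventually (gt_mem_nhds hd1)
  have hroot : ∀ (x : ℝ) (i : ℕ), 0 ≤ x → (x ^ ((2⁻¹ : ℝ) ^ (i + 1))) ^ (2 ^ (i + 1)) = x := by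
    intro x i hx
    rw [← Real.rpow_natCast, ← Real.rpow_mul hx]
    push_cast
    rw [← mul_pow]
    norm_num
  have hev : ∀ᶠ i : ℕ in atTop, r ^ (2 ^ (i + 1)) * (sylv n i : ℝ) ≤ a i := by
    filter_upwards [hev1, hev2] with i h1 h2
    have h3 := pow_le_pow_left₀ (by positivity) (h2.trans h1).le (2 ^ (i + 1))
    rwa [mul_pow, hroot _ _ (by positivity), hroot _ _ (by positivity)] at h3
  have hbigpow : ∀ᶠ i : ℕ in atTop, 2 ≤ (l * r ^ (2 ^ (k + 1))) ^ (2 ^ i) := by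
    have : Tendsto (fun i : ℕ => (l * r ^ (2 ^ (k + 1))) ^ (2 ^ i)) atTop atTop :=
      (tendsto_pow_atTop_atTop_of_one_lt hr).comp
        (tendsto_pow_atTop_atTop_of_one_lt (by norm_num : 1 < 2))
    exact this.eventually_ge_atTop 2
  filter_upwards [(tendsto_add_atTop_nat k).eventually hev, hbigpow] with i h1 h2
  have h3 := hratio i
  rw [hshift i] at h3
  have h4 : (2 : ℝ) * sylv q i ≤ a (i + k) := by
    calc (2 : ℝ) * sylv q i ≤ (l * r ^ (2 ^ (k + 1))) ^ (2 ^ i) * sylv q i := by gcongr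
      _ = r ^ (2 ^ (i + k + 1)) * (l ^ (2 ^ i) * sylv q i) := by
        rw [mul_pow, ← pow_mul, ← pow_add, show k + 1 + i = i + k + 1 by ring]; ring
      _ ≤ r ^ (2 ^ (i + k + 1)) * sylv n (i + k) := by gcongr
      _ ≤ _ := h1
  exact_mod_cast h4
end

section
/- Let u_i be the Sylvester-type sequence defined by u_1 = 2 and u_{i+1} = u_i^2 - u_i + 1 (equivalently, u_i = s_i(1)). If a_1 ≤ a_2 ≤ ⋯ is a nondecreasing sequence of positive integers with ∑_{i=1}^{∞} 1/a_i = 1 and a_i ≠ u_i for some i, then liminf_{i→∞} a_i^{2^{-i}} < lim_{i→∞} u_i^{2^{-i}}. -/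
open Filter Topology Finset

/-- product of the first `n` Sylvester numbers -/
def Uu (n : ℕ) : ℕ := ∏ i ∈ range n, sylv 1 i

lemma sylv_eq (n : ℕ) : sylv 1 n = Uu n + 1 := by
  induction n with
  | zero => simp [sylv, Uu]
  | succ n ih =>
    have h : Uu (n+1) = Uu n * sylv 1 n := by simp [Uu, prod_range_succ]
    rw [h]
    simp only [sylv]
    rw [ih]
    have : (Uu n + 1)^2 = Uu n * (Uu n + 1) + (Uu n + 1) := by ring
    rw [this, Nat.add_sub_cancel]

lemma Uu_succ (n : ℕ) : Uu (n+1) = Uu n * (Uu n + 1) := by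
  rw [← sylv_eq]; simp [Uu, prod_range_succ]

lemma Uu_pos (n : ℕ) : 0 < Uu n := by
  induction n with
  | zero => simp [Uu]
  | succ n ih => rw [Uu_succ]; positivity

lemma sum_sylv (n : ℕ) : ∑ i ∈ range n, (1:ℝ) / (sylv 1 i : ℝ) = 1 - 1 / (Uu n : ℝ) := by
  induction n with
  | zero => simp [Uu]
  | succ n ih =>
    have := Uu_pos n
    have h : (0:ℝ) < Uu n := by exact_mod_cast this
    rw [sum_range_succ, ih, Uu_succ, sylv_eq]
    push_cast
    field_simp
    ring

/-- Abel summation -/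
lemma abel_aux (a d : ℕ → ℝ) (n : ℕ) :
    ∑ i ∈ range (n+1), a i * d i = a n * ∑ i ∈ range (n+1), d i
      - ∑ i ∈ range n, (a (i+1) - a i) * ∑ j ∈ range (i+1), d j := by
  induction n with
  | zero => simp
  | succ n ih =>
    rw [sum_range_succ, ih, sum_range_succ (fun i => (a (i+1) - a i) * _),
      sum_range_succ (fun i => d i) (n+1)]
    ring

lemma numer (a : ℕ → ℕ) (hapos : ∀ i, 0 < a i) (n : ℕ) :
    ∃ z : ℤ, (z : ℝ) = (∏ i ∈ range n, (a i : ℝ)) * (1 - ∑ i ∈ range n, (1:ℝ) / (a i : ℝ)) := by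
  induction n with
  | zero => exact ⟨1, by simp⟩
  | succ n ih =>
    obtain ⟨z, hz⟩ := ih
    refine ⟨a n * z - ∏ i ∈ range n, (a i : ℤ), ?_⟩
    have h : (0:ℝ) < a n := by exact_mod_cast hapos n
    push_cast
    rw [hz, prod_range_succ, sum_range_succ]
    field_simp
    ring

lemma sound (a : ℕ → ℕ) (hapos : ∀ i, 0 < a i) (hamono : Monotone a)
    (hlt : ∀ n, ∑ i ∈ range n, (1:ℝ) / (a i : ℝ) < 1) (n : ℕ) :
    1 - 1 / (Uu n : ℝ) ≤ ∑ i ∈ range n, (1:ℝ) / (a i : ℝ) → ∀ i < n, a i = sylv 1 i := by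
  induction n using Nat.strong_induction_on with
  | _ n ih =>
  intro hle
  rcases n with _ | n
  · intro i hi; omega
  have ha : ∀ i, (0:ℝ) < a i := fun i => by exact_mod_cast hapos i
  have hu : ∀ i, (0:ℝ) < sylv 1 i := fun i => by rw [sylv_eq]; positivity
  set d : ℕ → ℝ := fun i => 1 / (sylv 1 i : ℝ) - 1 / (a i : ℝ) with hd
  have hD : ∀ m < n+1, 0 ≤ ∑ i ∈ range m, d i := by
    intro m hm
    simp only [hd, sum_sub_distrib, sum_sylv]
    by_contra! hcon
    have h1 := ih m hm (by linarith)
    have : ∑ i ∈ range m, (1:ℝ) / (a i : ℝ) = ∑ i ∈ range m, (1:ℝ) / (sylv 1 i : ℝ) :=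
      sum_congr rfl (fun i hi => by rw [h1 i (mem_range.1 hi)])
    rw [this, sum_sylv] at hcon
    linarith
  have hDn : ∑ i ∈ range (n+1), d i ≤ 0 := by
    simp only [hd, sum_sub_distrib, sum_sylv]; linarith
  have hab : ∑ i ∈ range (n+1), (a i : ℝ) * d i ≤ 0 := by
    rw [abel_aux (fun i => (a i : ℝ)) d n]
    have h1 : (a n : ℝ) * ∑ i ∈ range (n+1), d i ≤ 0 :=
      mul_nonpos_of_nonneg_of_nonpos (ha n).le hDn
    have h2 : 0 ≤ ∑ i ∈ range n, ((a (i+1) : ℝ) - a i) * ∑ j ∈ range (i+1), d j := by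
      apply sum_nonneg
      intro i hi
      apply mul_nonneg
      · have : a i ≤ a (i+1) := hamono (Nat.le_succ i)
        have : (a i : ℝ) ≤ a (i+1) := by exact_mod_cast this
        linarith
      · exact hD _ (by have := mem_range.1 hi; omega)
    linarith
  -- product
  have hPU : (Uu (n+1) : ℝ) ≤ ∏ i ∈ range (n+1), (a i : ℝ) := by
    obtain ⟨z, hz⟩ := numer a hapos (n+1)
    have hP : 0 < ∏ i ∈ range (n+1), (a i : ℝ) := prod_pos (fun i _ => ha i)
    have hzpos : (0:ℝ) < z := by
      rw [hz]; exact mul_pos hP (by have := hlt (n+1); linarith)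
    have hz1 : (1:ℝ) ≤ z := by
      have : 0 < z := by exact_mod_cast hzpos
      exact_mod_cast this
    have hU : (0:ℝ) < Uu (n+1) := by exact_mod_cast Uu_pos _
    have : (1:ℝ) ≤ (∏ i ∈ range (n+1), (a i : ℝ)) * (1 / (Uu (n+1) : ℝ)) := by
      calc (1:ℝ) ≤ z := hz1
        _ = _ := hz
        _ ≤ _ := by gcongr; linarith
    rw [mul_one_div, le_div_iff₀ hU] at this
    linarith
  have hlog : 0 ≤ ∑ i ∈ range (n+1), Real.log ((a i : ℝ) / sylv 1 i) := by
    rw [← Real.log_prod (fun i _ => (div_pos (ha i) (hu i)).ne')]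
    apply Real.log_nonneg
    rw [prod_div_distrib, one_le_div (prod_pos (fun i _ => hu i))]
    simpa [Uu] using hPU
  by_contra! hcon
  obtain ⟨k, hk, hne⟩ := hcon
  have hstrict : ∑ i ∈ range (n+1), Real.log ((a i : ℝ) / sylv 1 i)
      < ∑ i ∈ range (n+1), (a i : ℝ) * d i := by
    have he : ∀ i, (a i : ℝ) * d i = (a i : ℝ) / sylv 1 i - 1 := by
      intro i
      have := ha i
      have := hu i
      simp only [hd]; field_simp
    apply sum_lt_sum
    · intro i _
      rw [he]
      exact Real.log_le_sub_one_of_pos (div_pos (ha i) (hu i))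
    · refine ⟨k, mem_range.2 hk, ?_⟩
      rw [he]
      apply Real.log_lt_sub_one_of_pos (div_pos (ha k) (hu k))
      intro h
      rw [div_eq_one_iff_eq (hu k).ne'] at h
      exact hne (by exact_mod_cast h)
  linarith

lemma logU_le (c : ℝ)
    (hc : Tendsto (fun i : ℕ => (sylv 1 i : ℝ) ^ ((2⁻¹ : ℝ) ^ (i + 1))) atTop (𝓝 c)) :
    1 ≤ c ∧ ∀ n, Real.log (Uu n) < 2^(n+1) * Real.log c := by
  have hc1 : 1 ≤ c := by
    refine ge_of_tendsto' hc (fun i => ?_)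
    apply Real.one_le_rpow
    · rw [sylv_eq]; push_cast; linarith [(Nat.cast_nonneg (Uu i) : (0:ℝ) ≤ _)]
    · positivity
  have hUpos : ∀ n, (1:ℝ) ≤ Uu n := fun n => by exact_mod_cast Uu_pos n
  have hstep : ∀ n, 2 * Real.log (Uu n) < Real.log (Uu (n+1)) := by
    intro n
    have := hUpos n
    rw [Uu_succ]; push_cast
    rw [Real.log_mul (by positivity) (by positivity)]
    have : Real.log (Uu n) < Real.log (Uu n + 1) := Real.log_lt_log (by linarith) (by linarith)
    linarith
  have hlog : Tendsto (fun i : ℕ => (2⁻¹ : ℝ) ^ (i + 1) * Real.log (sylv 1 i)) atTop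
      (𝓝 (Real.log c)) := by
    have := hc.log (by linarith)
    refine this.congr (fun i => ?_)
    rw [Real.log_rpow]
    rw [sylv_eq]; positivity
  have hle : ∀ n, Real.log (Uu n) ≤ 2^(n+1) * Real.log c := by
    intro n
    have h1 : ∀ k, (2:ℝ)^k * Real.log (Uu n) ≤ Real.log (Uu (n+k)) := by
      intro k
      induction k with
      | zero => simp
      | succ k ih =>
        have := hstep (n+k)
        rw [pow_succ]
        rw [← add_assoc]
        linarith
    have h2 : (2⁻¹ : ℝ)^(n+1) * Real.log (Uu n) ≤ Real.log c := by
      refine ge_of_tendsto hlog ?_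
      filter_upwards [eventually_ge_atTop n] with m hm
      obtain ⟨k, rfl⟩ := Nat.exists_eq_add_of_le hm
      have h3 := h1 k
      have h4 : Real.log (Uu (n+k)) ≤ Real.log (sylv 1 (n+k)) := by
        apply Real.log_le_log
        · linarith [hUpos (n+k)]
        · rw [sylv_eq]; push_cast; linarith
      calc (2⁻¹ : ℝ)^(n+1) * Real.log (Uu n)
          = (2⁻¹ : ℝ)^(n+k+1) * (2^k * Real.log (Uu n)) := by
            rw [show n + k + 1 = (n+1) + k by ring, pow_add _ (n+1) k]
            simp only [inv_pow]
            field_simp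
        _ ≤ _ := by gcongr; linarith
    rw [inv_pow, inv_mul_le_iff₀ (by positivity)] at h2
    exact h2
  refine ⟨hc1, fun n => ?_⟩
  have h1 := hstep n
  have h2 := hle (n+1)
  rw [pow_succ] at h2
  linarith

lemma tail_bound (a : ℕ → ℕ) (l θ : ℝ) (hθ0 : 0 < θ)
    (hsummable : Summable (fun i : ℕ => (1 : ℝ) / (a i : ℝ)))
    (ha : ∀ᶠ i in atTop, Real.exp (θ * 2^(i+1)) ≤ a i) :
    ∀ᶠ n in atTop, (∑' i, (1 : ℝ) / (a (i + n) : ℝ)) ≤ 2 * Real.exp (-(θ * 2^(n+1))) := by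
  have hT : Tendsto (fun n : ℕ => θ * (2:ℝ)^(n+1)) atTop atTop :=
    ((tendsto_pow_atTop_atTop_of_one_lt (by norm_num : (1:ℝ) < 2)).comp
      (tendsto_add_atTop_nat 1)).const_mul_atTop hθ0
  have hsmall : ∀ᶠ n : ℕ in atTop, Real.exp (-(θ * (2:ℝ)^(n+1))) ≤ 1/2 := by
    have := (Real.tendsto_exp_neg_atTop_nhds_zero.comp hT)
    exact this.eventually_le_const (by norm_num : (0:ℝ) < 1/2)
  obtain ⟨n0, hn0⟩ := eventually_atTop.1 ha
  filter_upwards [hsmall, eventually_ge_atTop n0] with n hn hnn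
  set q := Real.exp (-(θ * (2:ℝ)^(n+1))) with hq
  have hq0 : 0 < q := Real.exp_pos _
  have hterm : ∀ i, (1 : ℝ) / (a (i + n) : ℝ) ≤ q * (1/2)^i := by
    intro i
    have h1 := hn0 (i+n) (by omega)
    have h2 : (1 : ℝ) / (a (i + n) : ℝ) ≤ 1 / Real.exp (θ * 2^(i+n+1)) := by
      apply one_div_le_one_div_of_le (Real.exp_pos _) h1
    have h3 : 1 / Real.exp (θ * 2^(i+n+1)) = q ^ (2^i) := by
      rw [hq, ← Real.exp_nat_mul, one_div, ← Real.exp_neg]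
      congr 1
      push_cast
      ring
    have h4 : q ^ (2^i) ≤ q^(i+1) :=
      pow_le_pow_of_le_one hq0.le (by linarith) Nat.lt_two_pow_self
    calc _ ≤ q^(i+1) := by linarith
      _ = q * q^i := by ring
      _ ≤ _ := by gcongr
  have hg : HasSum (fun i : ℕ => q * (1/2:ℝ)^i) (q * 2) := hasSum_geometric_two.mul_left q
  have hs : Summable (fun i => (1 : ℝ) / (a (i + n) : ℝ)) :=
    (summable_nat_add_iff n).2 hsummable
  have := hs.tsum_le_tsum hterm hg.summable
  rw [hg.tsum_eq] at this
  linarith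

lemma core (a N : ℕ → ℕ) (P R : ℕ → ℝ) (l : ℝ) (hl : 0 < l)
    (hU : ∀ n, Real.log (Uu n) < 2^(n+1) * l)
    (hapos : ∀ i, 0 < a i)
    (hP : ∀ n, 0 < P n) (hPs : ∀ n, P (n+1) = P n * a n)
    (hR : ∀ n, 0 < R n) (hRs : ∀ n, R n = 1 / a n + R (n+1))
    (hN : ∀ n, (N n : ℝ) = P n * R n)
    (hRU : ∀ n, 1 / (Uu n : ℝ) ≤ R n)
    (hRU' : ∀ᶠ n in atTop, R n ≠ 1 / (Uu n : ℝ))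
    (hRup : ∀ θ, 0 < θ → θ < l → ∀ᶠ n in atTop, R n ≤ 2 * Real.exp (-(θ * 2^(n+1)))) :
    False := by
  have hA : ∀ n, (0:ℝ) < a n := fun n => by exact_mod_cast hapos n
  have hNpos : ∀ n, (1:ℝ) ≤ N n := by
    intro n
    have : (0:ℝ) < N n := by rw [hN]; exact mul_pos (hP n) (hR n)
    have : 0 < N n := by exact_mod_cast this
    exact_mod_cast this
  have hUpos : ∀ n, (1:ℝ) ≤ Uu n := fun n => by exact_mod_cast Uu_pos n
  have hrec : ∀ n, (a n : ℝ) * N n = P n + N (n+1) := by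
    intro n
    have := hA n
    rw [hN, hN, hPs, hRs]
    field_simp
  have hUexp : ∀ n, (Uu n : ℝ) ≤ Real.exp (l * 2^(n+1)) := by
    intro n
    rw [← Real.log_le_iff_le_exp (by linarith [hUpos n])]
    linarith [hU n]
  have hRlow : ∀ n, Real.exp (-(l * 2^(n+1))) ≤ R n := by
    intro n
    refine le_trans ?_ (hRU n)
    rw [Real.exp_neg, ← one_div]
    exact one_div_le_one_div_of_le (by linarith [hUpos n]) (hUexp n)
  -- (B)
  have hB : ∀ θ, 0 < θ → θ < l → ∀ᶠ n in atTop, θ * 2^(n+1) - Real.log 2 ≤ Real.log (P n) := by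
    intro θ h0 h1
    filter_upwards [hRup θ h0 h1] with n hn
    have h2 : 1 ≤ P n * R n := by rw [← hN]; exact hNpos n
    have h3 : 1 ≤ P n * (2 * Real.exp (-(θ * 2^(n+1)))) :=
      h2.trans (by have := hP n; gcongr)
    have h4 := Real.log_nonneg h3
    rw [Real.log_mul (hP n).ne' (by positivity), Real.log_mul (by norm_num) (by positivity),
      Real.log_exp] at h4
    linarith
  set ε := l / 8 with hε
  have hε0 : 0 < ε := by positivity
  have hTt : Tendsto (fun n : ℕ => (2:ℝ)^(n+1)) atTop atTop :=
    (tendsto_pow_atTop_atTop_of_one_lt (by norm_num : (1:ℝ) < 2)).comp (tendsto_add_atTop_nat 1)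
  have hT : Tendsto (fun n : ℕ => ε * (2:ℝ)^(n+1)) atTop atTop := hTt.const_mul_atTop hε0
  have hRe := hRup (l - ε) (by linarith) (by linarith)
  -- a n ≤ 2 U n
  have haU : ∀ᶠ n in atTop, (a n : ℝ) ≤ 2 * Real.exp (l * 2^(n+1)) := by
    have hbig : ∀ᶠ n : ℕ in atTop, 4 ≤ Real.exp (ε * 2^(n+1)) :=
      (Real.tendsto_exp_atTop.comp hT).eventually_ge_atTop 4
    have hRe' := (tendsto_add_atTop_nat 1).eventually hRe
    filter_upwards [hRe', hbig] with n hn hb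
    have h1 : R (n+1) ≤ R n / 2 := by
      have h5 : 2 * Real.exp (-((l-ε) * 2^(n+1+1))) ≤ Real.exp (-(l * 2^(n+1))) / 2 := by
        have : Real.exp (-(l * 2^(n+1))) =
            Real.exp (-((l-ε) * 2^(n+1+1))) * Real.exp (ε * 2^(n+1)) *
              Real.exp (5 * (ε * 2^(n+1))) := by
          rw [← Real.exp_add, ← Real.exp_add]
          congr 1
          have : l = 8 * ε := by rw [hε]; ring
          rw [this]; ring
        rw [this]
        have h6 : 1 ≤ Real.exp (5 * (ε * 2^(n+1))) := Real.one_le_exp (by positivity)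
        have h7 : 4 ≤ Real.exp (ε * 2^(n+1)) * Real.exp (5 * (ε * 2^(n+1))) := by nlinarith
        have h8 := Real.exp_pos (-((l-ε) * 2^(n+1+1)))
        nlinarith
      linarith [hRlow n]
    have h2 : R n / 2 ≤ 1 / a n := by linarith [hRs n]
    have h3 : Real.exp (-(l * 2^(n+1))) / 2 ≤ 1 / a n := by linarith [hRlow n]
    rw [le_div_iff₀ (hA n), Real.exp_neg] at h3
    have := Real.exp_pos (l * 2^(n+1))
    field_simp at h3
    linarith
  obtain ⟨n0, hn0⟩ := eventually_atTop.1 haU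
  have hPup : ∀ k, P (n0 + k) ≤ P n0 * 2^(n0+k+1) * Real.exp (l * 2^(n0+k+1)) := by
    intro k
    have h0 := hP n0
    induction k with
    | zero =>
      simp only [add_zero]
      have h1 : (1:ℝ) ≤ 2^(n0+1) := one_le_pow₀ (by norm_num)
      have h2 : 1 ≤ Real.exp (l * 2^(n0+1)) := Real.one_le_exp (by positivity)
      have h3 : P n0 ≤ P n0 * 2^(n0+1) := le_mul_of_one_le_right h0.le h1
      exact h3.trans (le_mul_of_one_le_right (by positivity) h2)
    | succ k ih =>
      rw [← add_assoc, hPs]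
      calc P (n0+k) * a (n0+k) ≤ (P n0 * 2^(n0+k+1) * Real.exp (l * 2^(n0+k+1))) *
            (2 * Real.exp (l * 2^(n0+k+1))) := by
            gcongr
            exact hn0 _ (by omega)
        _ = P n0 * 2^(n0+k+1+1) * Real.exp (l * 2^(n0+k+1+1)) := by
            rw [pow_succ _ (n0+k+1), show l * (2^(n0+k+1) * 2 : ℝ) =
              l * 2^(n0+k+1) + l * 2^(n0+k+1) by ring, Real.exp_add]
            ring
  have hNup : ∀ᶠ n in atTop, (N n : ℝ) ≤ Real.exp (2 * (ε * 2^(n+1))) := by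
    have hbig : ∀ᶠ n : ℕ in atTop, 2 * P n0 / ε ≤ Real.exp (ε * 2^(n+1)) / (ε * 2^(n+1)) := by
      have := (Real.tendsto_exp_div_pow_atTop 1).comp hT
      simpa using this.eventually_ge_atTop (2 * P n0 / ε)
    filter_upwards [hRe, hbig, eventually_ge_atTop n0] with n h1 h2 h3
    obtain ⟨k, rfl⟩ := Nat.exists_eq_add_of_le h3
    have h4 := hPup k
    have h0 := hP n0
    rw [div_le_div_iff₀ hε0 (by positivity)] at h2
    have h5 : 2 * P n0 * 2^(n0+k+1) ≤ Real.exp (ε * 2^(n0+k+1)) := by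
      have : (2 * P n0 * 2^(n0+k+1)) * ε ≤ Real.exp (ε * 2^(n0+k+1)) * ε := by linarith
      exact le_of_mul_le_mul_right this hε0
    rw [hN]
    calc P (n0+k) * R (n0+k) ≤ (P n0 * 2^(n0+k+1) * Real.exp (l * 2^(n0+k+1))) *
          (2 * Real.exp (-((l-ε) * 2^(n0+k+1)))) := by
          have := hR (n0+k)
          gcongr
      _ = (2 * P n0 * 2^(n0+k+1)) *
          (Real.exp (l * 2^(n0+k+1)) * Real.exp (-((l-ε) * 2^(n0+k+1)))) := by ring
      _ = (2 * P n0 * 2^(n0+k+1)) * Real.exp (ε * 2^(n0+k+1)) := by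
          rw [← Real.exp_add]; congr 2; ring
      _ ≤ Real.exp (ε * 2^(n0+k+1)) * Real.exp (ε * 2^(n0+k+1)) := by gcongr
      _ = _ := by rw [← Real.exp_add]; congr 1; ring
  -- (A)
  have hAA : ∀ᶠ n in atTop, 8 * (N n : ℝ) * N (n+1) < P n := by
    have hbig : ∀ᶠ n : ℕ in atTop, 17 ≤ Real.exp (ε * 2^(n+1)) :=
      (Real.tendsto_exp_atTop.comp hT).eventually_ge_atTop 17
    filter_upwards [hNup, (tendsto_add_atTop_nat 1).eventually hNup, hRe, hbig] with n h1 h2 h3 h4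
    have h5 : 1 ≤ P n * R n := by rw [← hN]; exact hNpos n
    have h6 : 1 ≤ P n * (2 * Real.exp (-((l-ε) * 2^(n+1)))) :=
      h5.trans (by have := hP n; gcongr)
    set E := Real.exp (ε * 2^(n+1)) with hE
    have hE0 : 0 < E := Real.exp_pos _
    have e1 : Real.exp (2 * (ε * 2^(n+1))) = E^2 := by
      rw [hE, ← Real.exp_nat_mul]; norm_num
    have e2 : Real.exp (2 * (ε * 2^(n+1+1))) = E^4 := by
      rw [hE, ← Real.exp_nat_mul]; congr 1; push_cast; ring
    have e3 : Real.exp (-((l-ε) * 2^(n+1))) = (E^7)⁻¹ := by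
      rw [hE, ← Real.exp_nat_mul, ← Real.exp_neg]; congr 1
      have : l = 8 * ε := by rw [hε]; ring
      rw [this]; push_cast; ring
    rw [e1] at h1
    rw [e2] at h2
    rw [e3] at h6
    have h7 : E^7 ≤ 2 * P n := by
      field_simp at h6
      linarith
    calc 8 * (N n : ℝ) * N (n+1) ≤ 8 * E^2 * E^4 := by gcongr
      _ = 8 * E^6 := by ring
      _ < P n := by
        have : 17 * E^6 ≤ E^7 := by
          rw [show E^7 = E * E^6 by ring]; gcongr
        have : 0 < E^6 := by positivity
        linarith
  obtain ⟨n1, hn1⟩ := eventually_atTop.1 (hAA.and hRU')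
  -- minimal N
  obtain ⟨n, hn, hmin⟩ : ∃ n, n1 ≤ n ∧ ∀ m, n ≤ m → N n ≤ N m := by
    have hex : ∃ v, ∃ n, n1 ≤ n ∧ N n = v := ⟨_, n1, le_rfl, rfl⟩
    classical
    obtain ⟨n, hn, hv⟩ := Nat.find_spec hex
    refine ⟨n, hn, fun m hm => ?_⟩
    rw [hv]
    exact Nat.find_min' hex ⟨m, hn.trans hm, rfl⟩
  set K : ℕ := N n with hK
  have hK1 : (1:ℝ) ≤ K := hNpos n
  -- log recursion
  have hlogrec : ∀ m, n1 ≤ m → Real.log (P (m+1)) ≤ 2 * Real.log (P m) - Real.log (N m) +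
      1 / (8 * N m) := by
    intro m hm
    have h1 := (hn1 m hm).1
    have hp := hP m
    have hNm := hNpos m
    have h2 : P (m+1) = P m * (P m * (1 + N (m+1) / P m)) / N m := by
      rw [hPs]
      have := hrec m
      field_simp
      linarith
    have h3 : Real.log (1 + N (m+1) / P m) ≤ 1 / (8 * N m) := by
      have h4 : Real.log (1 + N (m+1) / P m) ≤ N (m+1) / P m := by
        have := Real.log_le_sub_one_of_pos (show 0 < 1 + (N (m+1) : ℝ) / P m by positivity)
        linarith
      refine h4.trans ?_
      rw [div_le_div_iff₀ hp (by positivity)]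
      linarith
    rw [h2, Real.log_div (by positivity) (by positivity), Real.log_mul (by positivity)
      (by positivity), Real.log_mul (by positivity) (by positivity)]
    linarith
  -- contradiction helper
  have hcontra : ∀ (M : ℕ) (κ C : ℝ), κ < 2^(M+1) * l →
      (∀ k, Real.log (P (M + k)) ≤ 2^k * κ + C) → False := by
    intro M κ C h1 h2
    have hM : (0:ℝ) < 2^(M+1) := by positivity
    have h3 : κ / 2^(M+1) < l := by rw [div_lt_iff₀ hM]; linarith
    obtain ⟨θ, hθ1, hθ2⟩ := exists_between (max_lt h3 hl)
    have hθ3 : 0 < θ := lt_of_le_of_lt (le_max_right _ _) hθ1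
    have hθ4 : κ < θ * 2^(M+1) := by
      rw [← div_lt_iff₀ hM]; exact lt_of_le_of_lt (le_max_left _ _) hθ1
    have hk : Tendsto (fun k : ℕ => (θ * 2^(M+1) - κ) * (2:ℝ)^k) atTop atTop :=
      (tendsto_pow_atTop_atTop_of_one_lt (by norm_num : (1:ℝ) < 2)).const_mul_atTop (by linarith)
    have hB' := (tendsto_add_atTop_nat M).eventually (hB θ hθ3 hθ2)
    obtain ⟨k, hk1, hk2⟩ := (hB'.and (hk.eventually_gt_atTop (C + Real.log 2))).exists
    have h4 := h2 k
    rw [add_comm M k] at h4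
    have : θ * 2^(k+M+1) = θ * 2^(M+1) * 2^k := by ring
    rw [this] at hk1
    linarith
  -- step
  have hRx : ∀ m, Real.log (P m) - Real.log (N m) ≤ Real.log (Uu m) := by
    intro m
    have h1 := hRU m
    have hp := hP m
    have hu := hUpos m
    have h2 : P m ≤ N m * Uu m := by
      rw [hN, mul_assoc]
      have : 1 ≤ R m * Uu m := by rwa [div_le_iff₀ (by linarith)] at h1
      exact le_mul_of_one_le_right hp.le this
    have h3 := Real.log_le_log hp h2
    rw [Real.log_mul (by have := hNpos m; positivity) (by positivity)] at h3
    linarith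
  have hstep : ∀ m, n ≤ m → N m = K → N (m+1) = K := by
    intro m hm hNm
    by_contra hne
    have hge : K + 1 ≤ N (m+1) := by
      have := hmin (m+1) (by omega); omega
    have hge' : (K:ℝ) + 1 ≤ N (m+1) := by exact_mod_cast hge
    set η : ℝ := 1 / (8 * K) with hη
    have hlogstep : ∀ j, n ≤ j → Real.log (P (j+1)) - Real.log K + η ≤
        2 * (Real.log (P j) - Real.log K + η) - (Real.log (N j) - Real.log K) := by
      intro j hj
      have h1 := hlogrec j (hn.trans hj)
      have h2 : (K:ℝ) ≤ N j := by exact_mod_cast hmin j hj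
      have h3 : 1 / (8 * (N j : ℝ)) ≤ η := by rw [hη]; gcongr
      linarith
    have hge0 : ∀ j, n ≤ j → 0 ≤ Real.log (N j) - Real.log K := by
      intro j hj
      have h2 : (K:ℝ) ≤ N j := by exact_mod_cast hmin j hj
      linarith [Real.log_le_log (by linarith) h2]
    have hgain : 4 * η < Real.log (N (m+1)) - Real.log K := by
      have h1 : Real.log (K+1) ≤ Real.log (N (m+1)) := Real.log_le_log (by linarith) hge'
      have h2 : 1 - ((K+1)/K : ℝ)⁻¹ ≤ Real.log ((K+1)/K) :=
        Real.one_sub_inv_le_log_of_pos (by positivity)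
      rw [Real.log_div (by positivity) (by positivity)] at h2
      have h3 : 4 * η ≤ 1 - ((K+1)/K : ℝ)⁻¹ := by
        rw [hη]
        have : (1:ℝ) - ((K+1)/K : ℝ)⁻¹ = 1/(K+1) := by field_simp; ring
        rw [this, mul_one_div, div_le_div_iff₀ (by positivity) (by positivity)]
        linarith
      rcases eq_or_lt_of_le h3 with h | h
      · have h4 : (1:ℝ) - ((K+1)/K : ℝ)⁻¹ < Real.log (K+1) - Real.log K := by
          rw [← Real.log_div (by positivity) (by positivity)]
          have h5 := Real.log_lt_sub_one_of_pos (x := ((K+1)/K : ℝ)⁻¹) (by positivity) (by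
            intro h6
            field_simp at h6
            linarith)
          rw [Real.log_inv] at h5
          linarith
        linarith
      · linarith
    have h1 := hlogstep m hm
    have h2 := hlogstep (m+1) (by omega)
    have h3 := hRx m
    rw [hNm] at h3 h1
    have h4 := hU m
    refine hcontra (m+1+1) (Real.log (P (m+1+1)) - Real.log K + η) (Real.log K - η) ?_ ?_
    · have : (2:ℝ)^(m+1+1+1) * l = 4 * (2^(m+1) * l) := by ring
      rw [this]
      linarith
    · intro k
      induction k with
      | zero => simp
      | succ k ih =>
        have h5 := hlogstep (m+1+1+k) (by omega)
        have h6 := hge0 (m+1+1+k) (by omega)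
        rw [← add_assoc, pow_succ]
        linarith
  have hconst : ∀ m, n ≤ m → N m = K := by
    intro m hm
    induction m, hm using Nat.le_induction with
    | base => rfl
    | succ m hm ih => exact hstep m hm ih
  -- P m = K * (a m - 1)
  have hPx : ∀ m, n ≤ m → P m = K * ((a m : ℝ) - 1) := by
    intro m hm
    have := hrec m
    rw [hconst m hm, hconst (m+1) (by omega)] at this
    linarith
  have hxU : a n ≤ Uu n := by
    have h1 := hRU n
    have h2 := (hn1 n hn).2
    have h3 : 1 / (Uu n : ℝ) < R n := lt_of_le_of_ne h1 (Ne.symm h2)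
    have h4 := hN n
    rw [hPx n le_rfl, ← hK] at h4
    have h5 : ((a n : ℝ) - 1) * R n = 1 := by
      have : (K:ℝ) * (((a n : ℝ) - 1) * R n) = K * 1 := by linarith
      exact mul_left_cancel₀ (by positivity) this
    have hu := hUpos n
    rw [div_lt_iff₀ (by linarith)] at h3
    have h6 : (a n : ℝ) - 1 < Uu n := by
      by_contra! hc
      have := hR n
      nlinarith
    have h7 : (a n : ℝ) < Uu n + 1 := by linarith
    have : a n < Uu n + 1 := by exact_mod_cast h7
    omega
  have hval : ∀ k, Real.log (a (n+k)) ≤ 2^k * Real.log (a n) := by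
    intro k
    induction k with
    | zero => simp
    | succ k ih =>
      have h1 := hPx (n+k) (by omega)
      have h2 := hPx (n+k+1) (by omega)
      rw [hPs, h1] at h2
      have h3 : (a (n+k+1) : ℝ) - 1 = ((a (n+k) : ℝ) - 1) * a (n+k) := by
        have : (K:ℝ) * ((a (n+k+1) : ℝ) - 1) = K * (((a (n+k) : ℝ) - 1) * a (n+k)) := by linarith
        exact mul_left_cancel₀ (by positivity) this
      have h4 : (1:ℝ) ≤ a (n+k) := by exact_mod_cast hapos (n+k)
      have h5 : (a (n+k+1) : ℝ) ≤ (a (n+k) : ℝ)^2 := by nlinarith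
      have h6 := Real.log_le_log (hA _) h5
      rw [Real.log_pow] at h6
      push_cast at h6
      rw [← add_assoc, pow_succ]
      linarith
  refine hcontra n (Real.log (a n)) (Real.log K) ?_ ?_
  · refine lt_of_le_of_lt (Real.log_le_log (hA n) ?_) (hU n)
    exact_mod_cast hxU
  · intro k
    have h1 := hval k
    have h2 := hPx (n+k) (by omega)
    have h3 : P (n+k) ≤ K * a (n+k) := by rw [h2]; nlinarith
    have h4 := Real.log_le_log (hP _) h3
    rw [Real.log_mul (by positivity) (hA _).ne'] at h4
    linarith

/-- Erdős' problem: if `a₁ ≤ a₂ ≤ ⋯` are positive integers with `∑ 1 / aᵢ = 1` and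
`aᵢ ≠ uᵢ = s_i(1)` for some `i`, then `liminf aᵢ ^ (2⁻¹ ^ i) < lim uᵢ ^ (2⁻¹ ^ i)`
(here `a i = a_{i+1}` and `sylv 1 i = u_{i+1}`). -/
theorem erdos_problem (a : ℕ → ℕ)
    (hapos : ∀ i, 0 < a i) (hamono : Monotone a)
    (hsum : HasSum (fun i : ℕ => (1 : ℝ) / (a i : ℝ)) 1)
    (hne : ∃ i, a i ≠ sylv 1 i)
    (c : ℝ)
    (hc : Tendsto (fun i : ℕ => (sylv 1 i : ℝ) ^ ((2⁻¹ : ℝ) ^ (i + 1))) atTop (𝓝 c)) :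
    Filter.liminf (fun i : ℕ => (a i : ℝ) ^ ((2⁻¹ : ℝ) ^ (i + 1))) atTop < c := by
  by_contra! hcon
  obtain ⟨hc1, hU⟩ := logU_le c hc
  have hA : ∀ n, (0:ℝ) < a n := fun n => by exact_mod_cast hapos n
  have hl : 0 < Real.log c := by
    have := hU 0
    simp [Uu] at this
    linarith
  have hlt : ∀ n, ∑ i ∈ range n, (1:ℝ) / (a i : ℝ) < 1 := by
    intro n
    have h1 : ∑ i ∈ range (n+1), (1:ℝ) / (a i : ℝ) ≤ 1 :=
      sum_le_hasSum _ (fun i _ => by positivity) hsum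
    rw [sum_range_succ] at h1
    have : (0:ℝ) < 1 / a n := one_div_pos.2 (hA n)
    linarith
  have hsound := sound a hapos hamono hlt
  have hP : ∀ n, 0 < ∏ i ∈ range n, (a i : ℝ) := fun n => prod_pos (fun i _ => hA i)
  have hnum : ∀ n, ∃ z : ℕ, (z : ℝ) =
      (∏ i ∈ range n, (a i : ℝ)) * (1 - ∑ i ∈ range n, (1:ℝ) / (a i : ℝ)) := by
    intro n
    obtain ⟨z, hz⟩ := numer a hapos n
    have : (0:ℝ) < z := by
      rw [hz]; exact mul_pos (hP n) (by linarith [hlt n])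
    have h0 : 0 ≤ z := by
      have : 0 < z := by exact_mod_cast this
      exact this.le
    lift z to ℕ using h0
    exact ⟨z, by exact_mod_cast hz⟩
  choose N hN using hnum
  refine core a N (fun n => ∏ i ∈ range n, (a i : ℝ))
    (fun n => 1 - ∑ i ∈ range n, (1:ℝ) / (a i : ℝ)) (Real.log c) hl hU hapos hP
    (fun n => prod_range_succ _ _) (fun n => by linarith [hlt n])
    (fun n => by rw [sum_range_succ]; ring) hN ?_ ?_ ?_
  · intro n
    by_contra! h
    have h1 := hsound n (by linarith)
    have : ∑ i ∈ range n, (1:ℝ) / (a i : ℝ) = ∑ i ∈ range n, (1:ℝ) / (sylv 1 i : ℝ) :=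
      sum_congr rfl (fun i hi => by rw [h1 i (mem_range.1 hi)])
    rw [this, sum_sylv] at h
    linarith
  · obtain ⟨i, hi⟩ := hne
    filter_upwards [eventually_gt_atTop i] with n hn h
    exact hi (hsound n (by linarith) i hn)
  · intro θ h0 h1
    have hb : ∀ᶠ i in atTop, Real.exp (θ * 2^(i+1)) ≤ a i := by
      have hlt' : Real.exp θ < Filter.liminf
          (fun i : ℕ => (a i : ℝ) ^ ((2⁻¹ : ℝ) ^ (i + 1))) atTop := by
        refine lt_of_lt_of_le ?_ hcon
        rwa [← Real.lt_log_iff_exp_lt (by linarith)]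
      have hbdd : IsBoundedUnder (· ≥ ·) atTop
          (fun i : ℕ => (a i : ℝ) ^ ((2⁻¹ : ℝ) ^ (i + 1))) :=
        isBoundedUnder_of ⟨0, fun i => by positivity⟩
      have hev := eventually_lt_of_lt_liminf hlt' hbdd
      filter_upwards [hev] with i hi
      have h2 := Real.log_le_log (Real.exp_pos _) hi.le
      rw [Real.log_exp, Real.log_rpow (hA i), inv_pow] at h2
      rw [← Real.le_log_iff_exp_le (hA i)]
      rw [le_inv_mul_iff₀ (by positivity)] at h2
      linarith
    filter_upwards [tail_bound a (Real.log c) θ h0 hsum.summable hb] with n hn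
    have := hsum.summable.sum_add_tsum_nat_add n
    rw [hsum.tsum_eq] at this
    linarith
end
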